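/- arXiv:1910.09850 — 4 statements merged into one kernel-verified Lean document; each statement's English description precedes it below -/
import Mathlib

section
/- Let F be an algebraically closed field with char F ≠ 2 and let n be a positive integer. Then the number of isomorphism classes of degree-n representations of the quaternion group Q8 of order 8 over F equals ∑_{s=0}^{⌊n/2⌋} C(n−2s+3, 3). -/
/-- Two representations of `G` on `Fin n → F` are isomorphic if there is an
`F`-linear isomorphism intertwining the group actions.  Since every
finite-dimensional representation of degree `n` is isomorphic to one on
`Fin n → F`, the isomorphism classes of degree-`n` representations of `G`
over `F` are exactly the classes of `Quot (repIsoRel F G n)`. -/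
def repIsoRel (F : Type) [Field F] (G : Type) [Monoid G] (n : ℕ)
    (ρ ρ' : Representation F G (Fin n → F)) : Prop :=
  ∃ e : (Fin n → F) ≃ₗ[F] (Fin n → F), ∀ (g : G) (v : Fin n → F), e (ρ g v) = ρ' g (e v)

/-- Elements `A`, `B` of a monoid satisfying the defining relations of `Q₈` determine a
homomorphism from `Q₈`. -/
def quaternionLift {M : Type*} [Monoid M] (A B : M) (hA : A ^ 4 = 1) (hB : B * B = A ^ 2)
    (hAB : A * B * A = B) : QuaternionGroup 2 →* M :=
  have hf : ∀ i j : ZMod (2 * 2), A ^ (i + j).val = A ^ i.val * A ^ j.val := fun i j => by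
    rw [ZMod.val_add, ← pow_add]
    exact (pow_eq_pow_mod _ hA).symm
  have hconj : ∀ k : ℕ, A ^ k * B * A ^ k = B := fun k => by
    induction k with
    | zero => simp
    | succ k ih =>
      rw [pow_succ, mul_assoc, mul_assoc, ← pow_succ, pow_succ', ← mul_assoc B, ← mul_assoc A,
        ← mul_assoc A, hAB, ← mul_assoc, ih]
  have hcomm : ∀ i : ZMod (2 * 2), A ^ i.val * B = B * A ^ (-i).val := fun i => by
    conv_rhs => rw [← hconj i.val]
    rw [mul_assoc _ (A ^ i.val), ← hf, add_neg_cancel, ZMod.val_zero, pow_zero, mul_one]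
  { toFun := fun g => match g with
      | .a i => A ^ i.val
      | .xa i => B * A ^ i.val
    map_one' := by
      rw [QuaternionGroup.one_def]
      simp
    map_mul' := by
      rintro (i | i) (j | j)
      · rw [QuaternionGroup.a_mul_a]
        exact hf i j
      · rw [QuaternionGroup.a_mul_xa]
        change B * A ^ (j - i).val = A ^ i.val * (B * A ^ j.val)
        rw [← mul_assoc, hcomm, mul_assoc, ← hf, neg_add_eq_sub]
      · rw [QuaternionGroup.xa_mul_a]
        change B * A ^ (i + j).val = B * A ^ i.val * A ^ j.val
        rw [mul_assoc, ← hf]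
      · rw [QuaternionGroup.xa_mul_xa]
        change A ^ (((2 : ℕ) : ZMod (2 * 2)) + j - i).val = B * A ^ i.val * (B * A ^ j.val)
        rw [mul_assoc, ← mul_assoc _ B, hcomm, mul_assoc, ← hf, ← mul_assoc, hB, add_sub_assoc,
          hf, neg_add_eq_sub]
        rfl }

lemma quaternionLift_a_one {M : Type*} [Monoid M] (A B : M) (hA : A ^ 4 = 1)
    (hB : B * B = A ^ 2) (hAB : A * B * A = B) :
    quaternionLift A B hA hB hAB (.a 1) = A :=
  pow_one A

lemma quaternionLift_xa_zero {M : Type*} [Monoid M] (A B : M) (hA : A ^ 4 = 1)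
    (hB : B * B = A ^ 2) (hAB : A * B * A = B) :
    quaternionLift A B hA hB hAB (.xa 0) = B :=
  show B * A ^ (0 : ZMod (2 * 2)).val = B by simp

namespace QuaternionRep

open Module

variable {F : Type*} [Field F]

/-- The eigenvalue of `a 1` on the `k`-th linear character of `Q₈`. -/
def signA (F : Type*) [Field F] : Fin 4 → F := ![1, 1, -1, -1]

/-- The eigenvalue of `xa 0` on the `k`-th linear character of `Q₈`. -/
def signB (F : Type*) [Field F] : Fin 4 → F := ![1, -1, 1, -1]

lemma signA_mul_self (k : Fin 4) : signA F k * signA F k = 1 := by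
  fin_cases k <;> simp [signA]

lemma signB_mul_self (k : Fin 4) : signB F k * signB F k = 1 := by
  fin_cases k <;> simp [signB]

lemma eq_of_sign_eq (h2 : (2 : F) ≠ 0) {j k : Fin 4} (hA : signA F j = signA F k)
    (hB : signB F j = signB F k) : j = k := by
  have h1 : (1 : F) ≠ -1 := fun h => h2 (by linear_combination h)
  fin_cases j <;> fin_cases k <;> simp_all [signA, signB, h1.symm]

section Weights

variable {V V' : Type*} [AddCommGroup V] [Module F V] [AddCommGroup V'] [Module F V']

/-- The joint eigenspace of `A` and `B` for the `k`-th linear character of `Q₈`. -/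
def charSpace (A B : End F V) (k : Fin 4) : Submodule F V :=
  A.eigenspace (signA F k) ⊓ B.eigenspace (signB F k)

lemma mem_charSpace {A B : End F V} {k : Fin 4} {v : V} :
    v ∈ charSpace A B k ↔ A v = signA F k • v ∧ B v = signB F k • v := by
  simp [charSpace]

/-- The multiplicities of the irreducible representations of `Q₈`: those of the four linear
characters, and that of the two-dimensional representation, where `i ^ 2 = -1`. -/
noncomputable def multiplicities (i : F) (A B : End F V) : (Fin 4 → ℕ) × ℕ :=
  (fun k => finrank F (charSpace A B k), finrank F (A.eigenspace i))

lemma multiplicities_congr (i : F) {A B : End F V} {A' B' : End F V'} (e : V ≃ₗ[F] V')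
    (hA : ∀ v, e (A v) = A' (e v)) (hB : ∀ v, e (B v) = B' (e v)) :
    multiplicities i A B = multiplicities i A' B' := by
  have hchar (k : Fin 4) : (charSpace A B k).map (e : V →ₗ[F] V') = charSpace A' B' k := by
    ext v
    obtain ⟨w, rfl⟩ := e.surjective v
    simp [mem_charSpace, ← hA, ← hB, ← map_smul]
  have heig : (A.eigenspace i).map (e : V →ₗ[F] V') = A'.eigenspace i := by
    ext v
    obtain ⟨w, rfl⟩ := e.surjective v
    simp [← hA, ← map_smul]
  refine Prod.ext (funext fun k => ?_) ?_
  · simp only [multiplicities]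
    rw [← hchar, LinearEquiv.finrank_map_eq]
  · simp only [multiplicities]
    rw [← heig, LinearEquiv.finrank_map_eq]

end Weights

section Model

variable (X : Fin 4 → Type*) (Y : Type*) [∀ k, AddCommGroup (X k)] [∀ k, Module F (X k)]
  [AddCommGroup Y] [Module F Y]

/-- The action of `a 1` on the sum of isotypic components with multiplicity spaces `X k`, `Y`. -/
def modelA (i : F) : End F ((∀ k, X k) × Y × Y) where
  toFun p := (fun k => signA F k • p.1 k, i • p.2.1, -(i • p.2.2))
  map_add' p q := by
    refine Prod.ext (funext fun k => ?_) (Prod.ext ?_ ?_) <;> simp [add_comm]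
  map_smul' c p := by
    refine Prod.ext (funext fun k => ?_) (Prod.ext ?_ ?_) <;> simp [smul_comm c]

/-- The action of `xa 0` on the sum of isotypic components with multiplicity spaces `X k`, `Y`. -/
def modelB : End F ((∀ k, X k) × Y × Y) where
  toFun p := (fun k => signB F k • p.1 k, -p.2.2, p.2.1)
  map_add' p q := by
    refine Prod.ext (funext fun k => ?_) (Prod.ext ?_ ?_) <;> simp [add_comm]
  map_smul' c p := by
    refine Prod.ext (funext fun k => ?_) (Prod.ext ?_ ?_) <;> simp [smul_comm c]

lemma modelA_apply (i : F) (p : (∀ k, X k) × Y × Y) :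
    modelA X Y i p = (fun k => signA F k • p.1 k, i • p.2.1, -(i • p.2.2)) := rfl

lemma modelB_apply (p : (∀ k, X k) × Y × Y) :
    modelB (F := F) X Y p = (fun k => signB F k • p.1 k, -p.2.2, p.2.1) := rfl

variable {i : F} (hi : i * i = -1)

include hi in
lemma modelA_pow_four : modelA X Y i ^ 4 = 1 := by
  refine LinearMap.ext fun p => Prod.ext (funext fun k => ?_) (Prod.ext ?_ ?_) <;>
    simp [pow_succ, modelA_apply, smul_smul, hi, signA_mul_self]

include hi in
lemma modelB_mul_modelB : modelB X Y * modelB X Y = modelA X Y i ^ 2 := by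
  refine LinearMap.ext fun p => Prod.ext (funext fun k => ?_) (Prod.ext ?_ ?_) <;>
    simp [pow_succ, modelA_apply, modelB_apply, smul_smul, hi, signA_mul_self, signB_mul_self]

include hi in
lemma modelA_mul_modelB_mul_modelA :
    modelA X Y i * modelB X Y * modelA X Y i = modelB X Y := by
  refine LinearMap.ext fun p => Prod.ext (funext fun k => ?_) (Prod.ext ?_ ?_) <;>
    simp [modelA_apply, modelB_apply, smul_smul, hi, signA_mul_self, mul_comm (signB F _),
      ← mul_assoc]

include hi in
lemma eq_zero_of_smul_eq_signA_smul {V : Type*} [AddCommGroup V] [Module F V]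
    (h2 : (2 : F) ≠ 0) {k : Fin 4} {v : V} (h : i • v = signA F k • v) : v = 0 := by
  have h3 : (2 : F) • v = 0 := by
    have h4 : i • i • v = signA F k • signA F k • v := by
      rw [← h, smul_comm (signA F k), ← h]
    rw [smul_smul, smul_smul, hi, signA_mul_self] at h4
    linear_combination (norm := module) -h4
  exact (smul_eq_zero.mp h3).resolve_left h2

include hi in
lemma eq_zero_of_neg_smul_eq_smul {V : Type*} [AddCommGroup V] [Module F V]
    (h2 : (2 : F) ≠ 0) {v : V} (h : -(i • v) = i • v) : v = 0 := by
  have h3 : (2 * i) • v = 0 := by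
    linear_combination (norm := module) -h
  refine (smul_eq_zero.mp h3).resolve_left (mul_ne_zero h2 ?_)
  rintro rfl
  simp at hi

include hi in
lemma charSpace_model (h2 : (2 : F) ≠ 0) (k : Fin 4) :
    charSpace (modelA X Y i) (modelB X Y) k =
      (LinearMap.inl F (∀ k, X k) (Y × Y) ∘ₗ LinearMap.single F X k).range := by
  ext p
  obtain ⟨x, y, z⟩ := p
  simp only [mem_charSpace, modelA_apply, modelB_apply, Prod.smul_mk, Prod.mk.injEq,
    LinearMap.mem_range, LinearMap.comp_apply, LinearMap.inl_apply, LinearMap.coe_single]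
  constructor
  · rintro ⟨⟨hx, hy, hz⟩, hx', -⟩
    refine ⟨x k, funext fun j => ?_, ?_⟩
    · by_cases hjk : j = k
      · subst hjk
        simp
      · rw [Pi.single_eq_of_ne hjk]
        by_contra hne
        have hne : x j ≠ 0 := fun h => hne h.symm
        exact hjk (eq_of_sign_eq h2 (smul_left_injective F hne (congrFun hx j))
          (smul_left_injective F hne (congrFun hx' j)))
    · have hz' : -i • z = signA F k • z := by rwa [neg_smul]
      rw [eq_zero_of_smul_eq_signA_smul hi h2 hy,
        eq_zero_of_smul_eq_signA_smul (by simpa using hi) h2 hz']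
      rfl
  · rintro ⟨w, rfl, h⟩
    obtain ⟨rfl, rfl⟩ := Prod.mk.inj h
    refine ⟨⟨funext fun j => ?_, by simp, by simp⟩, funext fun j => ?_, by simp, by simp⟩ <;>
    · by_cases hjk : j = k
      · subst hjk
        simp
      · simp [hjk]

include hi in
lemma eigenspace_model (h2 : (2 : F) ≠ 0) :
    (modelA X Y i).eigenspace i =
      (LinearMap.inr F (∀ k, X k) (Y × Y) ∘ₗ LinearMap.inl F Y Y).range := by
  ext p
  obtain ⟨x, y, z⟩ := p
  simp only [Module.End.mem_eigenspace_iff, modelA_apply, Prod.smul_mk, Prod.mk.injEq,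
    LinearMap.mem_range, LinearMap.comp_apply, LinearMap.inl_apply, LinearMap.inr_apply]
  constructor
  · rintro ⟨hx, -, hz⟩
    refine ⟨y, funext fun j => ?_, rfl, ?_⟩
    · exact (eq_zero_of_smul_eq_signA_smul hi h2 (congrFun hx j).symm).symm
    · exact (eq_zero_of_neg_smul_eq_smul hi h2 hz).symm
  · rintro ⟨w, rfl, rfl, rfl⟩
    exact ⟨funext fun j => by simp, by simp⟩

include hi in
lemma multiplicities_model (h2 : (2 : F) ≠ 0) :
    multiplicities i (modelA X Y i) (modelB X Y) = (fun k => finrank F (X k), finrank F Y) := by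
  refine Prod.ext (funext fun k => ?_) ?_
  · simp only [multiplicities]
    rw [charSpace_model X Y hi h2, LinearMap.finrank_range_of_inj]
    exact LinearMap.inl_injective.comp (Pi.single_injective k)
  · simp only [multiplicities]
    rw [eigenspace_model X Y hi h2, LinearMap.finrank_range_of_inj]
    exact LinearMap.inr_injective.comp LinearMap.inl_injective

end Model

section Decomposition

variable {V : Type*} [AddCommGroup V] [Module F V] {A B : End F V} {i : F}

/-- The sum of isotypic components maps to `V`. -/
noncomputable def fromModel (i : F) (A B : End F V) :
    ((∀ k, charSpace A B k) × A.eigenspace i × A.eigenspace i) →ₗ[F] V :=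
  LinearMap.coprod (∑ k, (charSpace A B k).subtype ∘ₗ LinearMap.proj k)
    (LinearMap.coprod (A.eigenspace i).subtype (B ∘ₗ (A.eigenspace i).subtype))

lemma fromModel_apply (p : (∀ k, charSpace A B k) × A.eigenspace i × A.eigenspace i) :
    fromModel i A B p = ∑ k, (p.1 k : V) + (p.2.1 + B p.2.2) := by
  simp [fromModel]

variable (hA : ∀ v, A (A (A (A v))) = v) (hB : ∀ v, B (B v) = A (A v))
  (hAB : ∀ v, A (B v) = B (A (A (A v)))) (hi : i * i = -1) (h2 : (2 : F) ≠ 0)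

include hAB hi in
lemma apply_apply_of_mem_eigenspace {z : V} (hz : A z = i • z) : A (B z) = -(i • B z) := by
  simp [hAB, hz, smul_smul, hi]

include hAB hi in
lemma fromModel_modelA (p : (∀ k, charSpace A B k) × A.eigenspace i × A.eigenspace i) :
    fromModel i A B (modelA (fun k => charSpace A B k) (A.eigenspace i) i p) =
      A (fromModel i A B p) := by
  obtain ⟨x, ⟨y, hy⟩, z, hz⟩ := p
  rw [Module.End.mem_eigenspace_iff] at hy hz
  simp [fromModel_apply, modelA_apply, hy, apply_apply_of_mem_eigenspace hAB hi hz,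
    (mem_charSpace.mp (x _).2).1]

include hB hi in
lemma fromModel_modelB (p : (∀ k, charSpace A B k) × A.eigenspace i × A.eigenspace i) :
    fromModel i A B (modelB (F := F) (fun k => charSpace A B k) (A.eigenspace i) p) =
      B (fromModel i A B p) := by
  obtain ⟨x, ⟨y, hy⟩, z, hz⟩ := p
  rw [Module.End.mem_eigenspace_iff] at hy hz
  simp [fromModel_apply, modelB_apply, hB, hz, smul_smul, hi, (mem_charSpace.mp (x _).2).2,
    add_comm]

include hB hAB hi h2 in
lemma fromModel_injective : Function.Injective (fromModel i A B) := by
  rw [injective_iff_map_eq_zero]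
  intro p h0
  have hstepA : ∀ q, fromModel i A B q = 0 →
      fromModel i A B (modelA (fun k => charSpace A B k) (A.eigenspace i) i q) = 0 := fun q hq => by
    rw [fromModel_modelA hAB hi, hq, map_zero]
  have h1 := hstepA _ h0
  have h2' := hstepA _ h1
  have h3 := hstepA _ h2'
  have h4 :
      fromModel i A B (modelB (F := F) (fun k => charSpace A B k) (A.eigenspace i) p) = 0 := by
    rw [fromModel_modelB hB hi, h0, map_zero]
  have h5 := hstepA _ h4
  have h6 := hstepA _ h5
  have h7 := hstepA _ h6
  obtain ⟨x, y, z⟩ := p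
  have hi0 : i ≠ 0 := by
    rintro rfl
    simp at hi
  simp only [fromModel_apply, modelA_apply, modelB_apply, Fin.sum_univ_four, signA, signB,
    Matrix.cons_val, smul_smul, smul_neg, hi, neg_smul, one_smul, neg_neg, mul_neg, mul_one,
    Submodule.coe_neg, Submodule.coe_smul, map_neg, map_smul]
    at h0 h1 h2' h3 h4 h5 h6 h7
  have h8 : (2 * 2 * 2 : F) ≠ 0 := by simp [h2]
  have h4i : (2 * 2 * i : F) ≠ 0 := by simp [h2, hi0]
  have hx : ∀ k, x k = 0 := fun k => by
    refine Subtype.ext ((smul_eq_zero.mp ?_).resolve_left h8)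
    fin_cases k
    · change (2 * 2 * 2 : F) • (x 0 : V) = 0
      linear_combination (norm := module) h0 + h1 + h2' + h3 + h4 + h5 + h6 + h7
    · change (2 * 2 * 2 : F) • (x 1 : V) = 0
      linear_combination (norm := module) h0 + h1 + h2' + h3 - h4 - h5 - h6 - h7
    · change (2 * 2 * 2 : F) • (x 2 : V) = 0
      linear_combination (norm := module) h0 - h1 + h2' - h3 + h4 - h5 + h6 - h7
    · change (2 * 2 * 2 : F) • (x 3 : V) = 0
      linear_combination (norm := module) h0 - h1 + h2' - h3 - h4 + h5 - h6 + h7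
  have hy : y = 0 := by
    refine Subtype.ext ((smul_eq_zero.mp ?_).resolve_left h4i)
    linear_combination (norm := module) i • h0 - i • h2' + h1 - h3
  have hz : z = 0 := by
    refine Subtype.ext ((smul_eq_zero.mp ?_).resolve_left h4i)
    linear_combination (norm := module) i • h6 - i • h4 - h5 + h7
  rw [funext hx, hy, hz]
  rfl

include hA hB hAB in
lemma add_smul_mem_charSpace (k : Fin 4) (v : V) :
    (v + signA F k • A v + A (A v) + signA F k • A (A (A v))) +
      signB F k • B (v + signA F k • A v + A (A v) + signA F k • A (A (A v))) ∈
        charSpace A B k := by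
  rw [mem_charSpace]
  fin_cases k <;> simp [signA, signB, hA, hB, hAB] <;> constructor <;> abel

include hA hi in
lemma sub_mem_eigenspace (v : V) :
    v - i • A v - A (A v) + i • A (A (A v)) ∈ A.eigenspace i := by
  simp only [Module.End.mem_eigenspace_iff, map_add, map_sub, map_smul, hA, smul_add, smul_sub,
    smul_smul, hi]
  module

include hA hB hAB hi h2 in
lemma fromModel_surjective : Function.Surjective (fromModel i A B) := by
  intro v
  have h8 : (2 * 2 * 2 : F) ≠ 0 := by simp [h2]
  suffices h : ∃ p, fromModel i A B p = (2 * 2 * 2 : F) • v by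
    obtain ⟨p, hp⟩ := h
    exact ⟨(2 * 2 * 2 : F)⁻¹ • p, by rw [map_smul, hp, inv_smul_smul₀ h8]⟩
  refine ⟨(fun k => ⟨_, add_smul_mem_charSpace hA hB hAB k v⟩,
    (2 : F) • ⟨_, sub_mem_eigenspace hA hi v⟩, -((2 : F) • ⟨_, sub_mem_eigenspace hA hi (B v)⟩)), ?_⟩
  simp [fromModel_apply, Fin.sum_univ_four, signA, signB, hA, hB, hAB]
  module

include hA hB hAB hi h2 in
lemma exists_model_equiv [FiniteDimensional F V] {m : Fin 4 → ℕ} {s : ℕ}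
    (hm : multiplicities i A B = (m, s)) :
    ∃ e : ((∀ k, Fin (m k) → F) × (Fin s → F) × (Fin s → F)) ≃ₗ[F] V,
      (∀ p, e (modelA (fun k => Fin (m k) → F) (Fin s → F) i p) = A (e p)) ∧
      ∀ p, e (modelB (F := F) (fun k => Fin (m k) → F) (Fin s → F) p) = B (e p) := by
  have hm1 : ∀ k, finrank F (Fin (m k) → F) = finrank F (charSpace A B k) := fun k => by
    rw [finrank_fin_fun]
    exact (congrFun (congrArg Prod.fst hm) k).symm
  have hm2 : finrank F (Fin s → F) = finrank F (A.eigenspace i) := by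
    rw [finrank_fin_fun]
    exact (congrArg Prod.snd hm).symm
  let f := fun k => LinearEquiv.ofFinrankEq _ _ (hm1 k)
  let g := LinearEquiv.ofFinrankEq _ _ hm2
  refine ⟨((LinearEquiv.piCongrRight f).prodCongr (g.prodCongr g)).trans
    (LinearEquiv.ofBijective (fromModel i A B)
      (show Function.Bijective _ from
        ⟨fromModel_injective hB hAB hi h2, fromModel_surjective hA hB hAB hi h2⟩)),
    fun p => ?_, fun p => ?_⟩
  · simp only [LinearEquiv.trans_apply, LinearEquiv.ofBijective_apply]
    rw [← fromModel_modelA hAB hi]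
    congr 1
    refine Prod.ext (funext fun k => ?_) (Prod.ext ?_ ?_) <;> simp [modelA_apply]
  · simp only [LinearEquiv.trans_apply, LinearEquiv.ofBijective_apply]
    rw [← fromModel_modelB hB hi]
    congr 1
    refine Prod.ext (funext fun k => ?_) (Prod.ext ?_ ?_) <;> simp [modelB_apply]

end Decomposition

section Representation

variable {V V' : Type*} [AddCommGroup V] [Module F V] [AddCommGroup V'] [Module F V']

/-- The multiplicities of the irreducible representations of `Q₈` in `ρ`. -/
noncomputable def repMultiplicities (i : F) (ρ : Representation F (QuaternionGroup 2) V) :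
    (Fin 4 → ℕ) × ℕ :=
  multiplicities i (ρ (.a 1)) (ρ (.xa 0))

lemma intertwines_of_generators {ρ : Representation F (QuaternionGroup 2) V}
    {ρ' : Representation F (QuaternionGroup 2) V'} (e : V →ₗ[F] V')
    (ha : ∀ v, e (ρ (.a 1) v) = ρ' (.a 1) (e v)) (hx : ∀ v, e (ρ (.xa 0) v) = ρ' (.xa 0) (e v))
    (g : QuaternionGroup 2) (v : V) : e (ρ g v) = ρ' g (e v) := by
  have hpow : ∀ (k : ℕ) (v : V), e (ρ (.a k) v) = ρ' (.a k) (e v) := fun k => by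
    rw [← QuaternionGroup.a_one_pow, map_pow, map_pow]
    induction k with
    | zero => simp
    | succ k ih => simp [pow_succ, ih, ha]
  have ha' : ∀ (j : ZMod (2 * 2)) (v : V), e (ρ (.a j) v) = ρ' (.a j) (e v) := fun j v => by
    simpa using hpow j.val v
  obtain j | j := g
  · exact ha' j v
  · have hj : (.xa j : QuaternionGroup 2) = .xa 0 * .a j := by simp
    simp [hj, -QuaternionGroup.xa_mul_a, hx, ha']

variable {i : F} (hi : i * i = -1) (h2 : (2 : F) ≠ 0)

include hi h2 in
lemma exists_model_equiv_rep [FiniteDimensional F V] (ρ : Representation F (QuaternionGroup 2) V)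
    {m : Fin 4 → ℕ} {s : ℕ} (hm : repMultiplicities i ρ = (m, s)) :
    ∃ e : ((∀ k, Fin (m k) → F) × (Fin s → F) × (Fin s → F)) ≃ₗ[F] V,
      (∀ p, e (modelA (fun k => Fin (m k) → F) (Fin s → F) i p) = ρ (.a 1) (e p)) ∧
      ∀ p, e (modelB (F := F) (fun k => Fin (m k) → F) (Fin s → F) p) = ρ (.xa 0) (e p) := by
  have r1 : (.a 1 * (.a 1 * (.a 1 * .a 1)) : QuaternionGroup 2) = 1 := by decide
  have r2 : (.xa 0 * .xa 0 : QuaternionGroup 2) = .a 1 * .a 1 := by decide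
  have r3 : (.a 1 * .xa 0 : QuaternionGroup 2) = .xa 0 * (.a 1 * (.a 1 * .a 1)) := by decide
  refine exists_model_equiv (fun v => ?_) (fun v => ?_) (fun v => ?_) hi h2 hm
  · simpa only [map_mul, map_one, Module.End.mul_apply, Module.End.one_apply] using
      LinearMap.congr_fun (congrArg ρ r1) v
  · simpa only [map_mul, Module.End.mul_apply] using LinearMap.congr_fun (congrArg ρ r2) v
  · simpa only [map_mul, Module.End.mul_apply] using LinearMap.congr_fun (congrArg ρ r3) v

lemma finrank_model (m : Fin 4 → ℕ) (s : ℕ) :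
    finrank F ((∀ k, Fin (m k) → F) × (Fin s → F) × (Fin s → F)) = ∑ k, m k + 2 * s := by
  simp [two_mul, finrank_pi_fintype]

include hi h2 in
lemma sum_repMultiplicities [FiniteDimensional F V]
    (ρ : Representation F (QuaternionGroup 2) V) :
    ∑ k, (repMultiplicities i ρ).1 k + 2 * (repMultiplicities i ρ).2 = finrank F V := by
  obtain ⟨e, -⟩ := exists_model_equiv_rep hi h2 ρ rfl
  rw [← e.finrank_eq, finrank_model]
  rfl

include hi h2 in
lemma exists_equiv_of_repMultiplicities_eq [FiniteDimensional F V] [FiniteDimensional F V']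
    {ρ : Representation F (QuaternionGroup 2) V} {ρ' : Representation F (QuaternionGroup 2) V'}
    (h : repMultiplicities i ρ = repMultiplicities i ρ') :
    ∃ e : V ≃ₗ[F] V', ∀ g v, e (ρ g v) = ρ' g (e v) := by
  obtain ⟨e, heA, heB⟩ := exists_model_equiv_rep hi h2 ρ rfl
  obtain ⟨e', heA', heB'⟩ := exists_model_equiv_rep hi h2 ρ' h.symm
  refine ⟨e.symm.trans e', intertwines_of_generators (e.symm.trans e').toLinearMap ?_ ?_⟩ <;>
  · intro v
    obtain ⟨p, rfl⟩ := e.surjective v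
    simp [← heA, ← heB, heA', heB']

include hi h2 in
lemma exists_rep_of_sum_eq [FiniteDimensional F V] {m : Fin 4 → ℕ} {s : ℕ}
    (h : ∑ k, m k + 2 * s = finrank F V) :
    ∃ ρ : Representation F (QuaternionGroup 2) V, repMultiplicities i ρ = (m, s) := by
  let X : Fin 4 → Type _ := fun k => Fin (m k) → F
  let Y := Fin s → F
  let e := LinearEquiv.ofFinrankEq _ V ((finrank_model (F := F) m s).trans h)
  let ρ₀ := quaternionLift (modelA X Y i) (modelB X Y) (modelA_pow_four X Y hi)
    (modelB_mul_modelB X Y hi) (modelA_mul_modelB_mul_modelA X Y hi)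
  refine ⟨(e.conjAlgEquiv F : _ →* _).comp ρ₀, ?_⟩
  have := multiplicities_model X Y hi h2
  simp only [X, Y, finrank_fin_fun] at this
  rw [← this]
  refine (multiplicities_congr i e (fun v => ?_) (fun v => ?_)).symm
  · simp [ρ₀, quaternionLift_a_one, X, Y]
  · simp [ρ₀, quaternionLift_xa_zero, X, Y]

end Representation

lemma card_multiplicities (n : ℕ) :
    Nat.card {p : (Fin 4 → ℕ) × ℕ // ∑ k, p.1 k + 2 * p.2 = n} =
      ∑ s ∈ Finset.range (n / 2 + 1), (n - 2 * s + 3).choose 3 := by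
  have hcard : ∀ d : ℕ, Nat.card {f : Fin 4 → ℕ // ∑ k, f k = d} = (d + 3).choose 3 := fun d => by
    rw [← Nat.card_congr (Sym.equivNatSumOfFintype (Fin 4) d), Nat.card_eq_fintype_card,
      Sym.card_sym_eq_choose, Fintype.card_fin, show 4 + d - 1 = d + 3 by omega,
      Nat.choose_symm_add]
  let e : {p : (Fin 4 → ℕ) × ℕ // ∑ k, p.1 k + 2 * p.2 = n} ≃
      Σ s : Fin (n / 2 + 1), {f : Fin 4 → ℕ // ∑ k, f k = n - 2 * s} :=
    { toFun := fun p => ⟨⟨p.1.2, by have := p.2; omega⟩, p.1.1, by have := p.2; simp; omega⟩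
      invFun := fun q => ⟨(q.2.1, q.1), by have := q.2.2; have := q.1.2; simp; omega⟩
      left_inv := fun p => rfl
      right_inv := fun q => rfl }
  have : ∀ d : ℕ, Finite {f : Fin 4 → ℕ // ∑ k, f k = d} := fun d =>
    Finite.of_equiv _ (Sym.equivNatSumOfFintype (Fin 4) d)
  rw [Nat.card_congr e, Nat.card_sigma, ← Fin.sum_univ_eq_sum_range
    (fun s => (n - 2 * s + 3).choose 3)]
  exact Finset.sum_congr rfl fun s _ => hcard _

end QuaternionRep

/-- The number of isomorphism classes of degree-`n` representations of the
quaternion group `Q₈` of order `8` over an algebraically closed field of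
characteristic `≠ 2` is `∑_{s=0}^{⌊n/2⌋} C(n-2s+3, 3)`. -/
theorem numRep_quaternion (F : Type) [Field F] [IsAlgClosed F]
    (hF : ringChar F ≠ 2) (n : ℕ) (hn : 0 < n) :
    Nat.card (Quot (repIsoRel F (QuaternionGroup 2) n)) =
      ∑ s ∈ Finset.range (n / 2 + 1), (n - 2 * s + 3).choose 3 := by
  have h2 : (2 : F) ≠ 0 := Ring.two_ne_zero hF
  obtain ⟨i, hi⟩ := IsAlgClosed.exists_eq_mul_self (-1 : F)
  replace hi := hi.symm
  rw [← QuaternionRep.card_multiplicities]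
  let T : Quot (repIsoRel F (QuaternionGroup 2) n) →
      {p : (Fin 4 → ℕ) × ℕ // ∑ k, p.1 k + 2 * p.2 = n} :=
    Quot.lift (fun ρ => ⟨QuaternionRep.repMultiplicities i ρ,
      (QuaternionRep.sum_repMultiplicities hi h2 ρ).trans (Module.finrank_fin_fun F)⟩)
      fun ρ ρ' ⟨e, he⟩ => Subtype.ext (QuaternionRep.multiplicities_congr i e (he _) (he _))
  refine Nat.card_eq_of_bijective T ⟨?_, ?_⟩
  · rintro ⟨ρ⟩ ⟨ρ'⟩ h
    exact Quot.sound (QuaternionRep.exists_equiv_of_repMultiplicities_eq hi h2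
      (congrArg Subtype.val h))
  · rintro ⟨⟨m, s⟩, h⟩
    obtain ⟨ρ, hρ⟩ := QuaternionRep.exists_rep_of_sum_eq hi h2
      (h.trans (Module.finrank_fin_fun F).symm)
    exact ⟨Quot.mk _ ρ, Subtype.ext hρ⟩
end

section
/- Let F be an algebraically closed field with char F ≠ 2. Every finite-dimensional representation (ρ, V) of the quaternion group Q8 of order 8 over F admits a non-degenerate invariant bilinear form. -/
open Module

/-- Every endomorphism `P` has a bilinear form on the ambient space that is non-degenerate on the
range of `P`. -/
lemma exists_bilinForm_nondeg_on_range {F V : Type*} [Field F] [AddCommGroup V] [Module F V]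
    [FiniteDimensional F V] (P : End F V) :
    ∃ b : V →ₗ[F] V →ₗ[F] F, ∀ x, (∀ y, b (P x) (P y) = 0) → P x = 0 := by
  obtain ⟨π, hπ⟩ := LinearMap.exists_leftInverse_of_injective
    (LinearMap.range P).subtype (by simp)
  have hπ' (x : V) : π (P x) = ⟨P x, x, rfl⟩ :=
    LinearMap.congr_fun hπ (⟨P x, x, rfl⟩ : LinearMap.range P)
  let e := finBasis F (LinearMap.range P)
  refine ⟨e.toDual.compl₁₂ π π, fun x hx => ?_⟩
  have h0 : e.toDual ⟨P x, x, rfl⟩ = 0 := by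
    ext ⟨_, y, rfl⟩
    simpa [hπ'] using hx y
  exact congrArg Subtype.val (e.toDual_injective (h0.trans (map_zero _).symm))

section QuaternionRelations

variable {F E : Type*} [Field F] [Ring E] [Algebra F E]

/-- An element onto which right multiplication by `A` and `X` acts through the character
`A ↦ s`, `X ↦ t`, for `A` and `X` satisfying the relations of `Q₈`. -/
def quaternionCharProj (A X : E) (s t : F) : E :=
  (1 + A * A) * (1 + s • A) * (1 + t • X)

/-- An element onto which right multiplication by `A` acts by `i`, if `A ^ 4 = 1`
and `i ^ 2 = -1`. -/
def quaternionEigenProj (A : E) (i : F) : E :=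
  (1 - A * A) * (1 - i • A)

variable {A X : E} {s t i : F}

lemma quaternionCharProj_mul_left (hA : A * A * A * A = 1) (hXA : X * A = A * A * A * X)
    (hs : s * s = 1) :
    quaternionCharProj A X s t * A = s • quaternionCharProj A X s t := by
  have hA' (y : E) : A * (A * (A * (A * y))) = y := by simp only [← mul_assoc, hA, one_mul]
  simp only [mul_assoc] at hA hXA
  simp only [quaternionCharProj, mul_assoc, mul_add, add_mul, one_mul, mul_one, smul_mul_assoc,
    mul_smul_comm, hA, hXA, hA', smul_add, smul_smul]
  match_scalars <;> grind

lemma quaternionCharProj_mul_right (hA : A * A * A * A = 1) (hXX : X * X = A * A)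
    (ht : t * t = 1) :
    quaternionCharProj A X s t * X = t • quaternionCharProj A X s t := by
  simp only [mul_assoc] at hA
  simp only [quaternionCharProj, mul_assoc, mul_add, add_mul, one_mul, mul_one, smul_mul_assoc,
    mul_smul_comm, hA, hXX, smul_add, smul_smul]
  match_scalars <;> grind

lemma quaternionEigenProj_mul (hA : A * A * A * A = 1) (hi : i * i = -1) :
    quaternionEigenProj A i * A = i • quaternionEigenProj A i := by
  simp only [mul_assoc] at hA
  simp only [quaternionEigenProj, mul_assoc, mul_sub, sub_mul, one_mul, mul_one, smul_mul_assoc,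
    mul_smul_comm, hA, smul_sub, smul_smul]
  match_scalars <;> grind

lemma quaternionEigenProj_mul_swap (hA : A * A * A * A = 1) (hXA : X * A = A * A * A * X) :
    quaternionEigenProj A i * X = X * quaternionEigenProj A (-i) := by
  have hA' (y : E) : A * (A * (A * (A * y))) = y := by simp only [← mul_assoc, hA, one_mul]
  have hXA' (y : E) : X * (A * y) = A * (A * (A * (X * y))) := by
    simp only [← mul_assoc, hXA]
  simp only [mul_assoc] at hXA
  simp only [quaternionEigenProj, mul_assoc, mul_sub, sub_mul, one_mul, mul_one, smul_mul_assoc,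
    mul_smul_comm, hXA, hXA', hA', smul_sub]
  match_scalars <;> grind

lemma sum_quaternionProj :
    quaternionCharProj A X (1 : F) 1 + quaternionCharProj A X (1 : F) (-1)
      + quaternionCharProj A X (-1 : F) 1 + quaternionCharProj A X (-1 : F) (-1)
      + (2 : F) • (quaternionEigenProj A i + quaternionEigenProj A (-i)) = (8 : F) • (1 : E) := by
  simp only [quaternionEigenProj, quaternionCharProj, mul_assoc, mul_sub, sub_mul, mul_add,
    add_mul, one_mul, mul_one, smul_mul_assoc, mul_smul_comm, smul_sub, smul_add, smul_smul]
  match_scalars <;> grind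

end QuaternionRelations

/-- A pair of endomorphisms satisfying the relations of `Q₈` preserves a non-degenerate bilinear
form. -/
lemma exists_nondeg_form_of_quaternion_relations {F V : Type*} [Field F] [AddCommGroup V]
    [Module F V] [FiniteDimensional F V] (h2 : (2 : F) ≠ 0) {i : F} (hi : i * i = -1)
    {A X : End F V} (hA : A * A * A * A = 1) (hXX : X * X = A * A)
    (hXA : X * A = A * A * A * X) :
    ∃ B : V →ₗ[F] V →ₗ[F] F,
      (∀ x y, B (A x) (A y) = B x y) ∧ (∀ x y, B (X x) (X y) = B x y) ∧
      (∀ x, (∀ y, B x y = 0) → x = 0) := by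
  choose b hb using exists_bilinForm_nondeg_on_range (F := F) (V := V)
  let P : F → F → End F V := quaternionCharProj A X
  let Q : F → End F V := quaternionEigenProj A
  have hPA (s t : F) (hs : s * s = 1) (x : V) : P s t (A x) = s • P s t x :=
    LinearMap.congr_fun (quaternionCharProj_mul_left (t := t) hA hXA hs) x
  have hPX (s t : F) (ht : t * t = 1) (x : V) : P s t (X x) = t • P s t x :=
    LinearMap.congr_fun (quaternionCharProj_mul_right (s := s) hA hXX ht) x
  have hQA (j : F) (hj : j * j = -1) (x : V) : Q j (A x) = j • Q j x :=
    LinearMap.congr_fun (quaternionEigenProj_mul hA hj) x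
  have hQX (j : F) (x : V) : Q j (X x) = X (Q (-j) x) :=
    LinearMap.congr_fun (quaternionEigenProj_mul_swap hA hXA) x
  have hXXx (x : V) : X (X x) = A (A x) := LinearMap.congr_fun hXX x
  have hAx (x : V) : A (A (A (A x))) = x := LinearMap.congr_fun hA x
  have hXAx (x : V) : X (A x) = A (A (A (X x))) := LinearMap.congr_fun hXA x
  have hi' : -i * -i = -1 := by rw [neg_mul_neg, hi]
  have hPdef (s t : F) (x : V) : P s t x =
      (x + t • X x + s • A (x + t • X x)) + A (A (x + t • X x + s • A (x + t • X x))) := rfl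
  have hQdef (j : F) (x : V) : Q j x = (x - j • A x) - A (A (x - j • A x)) := rfl
  have hPP (s t s' t' : F) (hs : s * s = 1) (ht : t * t = 1) (x : V) :
      P s t (P s' t' x) = (2 * (1 + s * s') * (1 + t * t')) • P s t x := by
    rw [hPdef s' t']
    simp only [map_add, map_smul, hPA s t hs, hPX s t ht]
    match_scalars
    grind
  have hPQ (s t j : F) (hs : s * s = 1) (x : V) : P s t (Q j x) = 0 := by
    rw [hQdef]
    simp only [map_sub, map_smul, hPA s t hs]
    match_scalars
    grind
  have hQP (s t j : F) (hj : j * j = -1) (x : V) : Q j (P s t x) = 0 := by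
    rw [hPdef]
    simp only [map_add, map_smul, hQA j hj]
    match_scalars <;> grind
  have hQQ (j k : F) (hj : j * j = -1) (x : V) :
      Q j (Q k x) = (2 * (1 - j * k)) • Q j x := by
    rw [hQdef k]
    simp only [map_sub, map_smul, hQA j hj]
    match_scalars
    grind
  have h1 : (1 : F) * 1 = 1 := one_mul 1
  have h1' : (-1 : F) * -1 = 1 := by ring
  let B : V →ₗ[F] V →ₗ[F] F :=
    (b (P 1 1)).compl₁₂ (P 1 1) (P 1 1) + (b (P 1 (-1))).compl₁₂ (P 1 (-1)) (P 1 (-1))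
      + (b (P (-1) 1)).compl₁₂ (P (-1) 1) (P (-1) 1)
      + (b (P (-1) (-1))).compl₁₂ (P (-1) (-1)) (P (-1) (-1))
      + ((b (Q i)).compl₁₂ (Q i) (Q i ∘ₗ X) - (b (Q i)).compl₁₂ (Q i ∘ₗ X) (Q i))
  have hB (x y : V) : B x y = b (P 1 1) (P 1 1 x) (P 1 1 y)
      + b (P 1 (-1)) (P 1 (-1) x) (P 1 (-1) y) + b (P (-1) 1) (P (-1) 1 x) (P (-1) 1 y)
      + b (P (-1) (-1)) (P (-1) (-1) x) (P (-1) (-1) y)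
      + (b (Q i) (Q i x) (Q i (X y)) - b (Q i) (Q i (X x)) (Q i y)) := rfl
  refine ⟨B, fun x y => ?_, fun x y => ?_, fun x hx => ?_⟩
  · simp only [hB, hPA _ _ h1, hPA _ _ h1', hXAx, hQA _ hi, map_smul, LinearMap.smul_apply,
      smul_eq_mul]
    grind
  · simp only [hB, hPX _ _ h1, hPX _ _ h1', hXXx, hQA _ hi, map_smul, LinearMap.smul_apply,
      smul_eq_mul]
    grind
  · have h8 : (8 : F) ≠ 0 := by
      rw [show (8 : F) = 2 * 2 * 2 by norm_num]
      simp [h2]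
    have hP (s t : F) (hs : s * s = 1) (ht : t * t = 1) (y : V) : B x (P s t y) =
        8 * b (P s t) (P s t x) (P s t y) := by
      have hs' : s = 1 ∨ s = -1 := mul_self_eq_one_iff.mp hs
      have ht' : t = 1 ∨ t = -1 := mul_self_eq_one_iff.mp ht
      rw [hB]
      simp only [hPP _ _ _ _ h1 h1, hPP _ _ _ _ h1 h1', hPP _ _ _ _ h1' h1, hPP _ _ _ _ h1' h1',
        hQX, hQP _ _ _ hi, hQP _ _ _ hi', map_smul, smul_eq_mul, map_zero]
      rcases hs' with rfl | rfl <;> rcases ht' with rfl | rfl <;> ring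
    have hP0 (s t : F) (hs : s * s = 1) (ht : t * t = 1) : P s t x = 0 :=
      hb _ x fun y => (mul_eq_zero.mp ((hP s t hs ht y).symm.trans (hx _))).resolve_left h8
    have hB' (y : V) : b (Q i) (Q i x) (Q i (X y)) = b (Q i) (Q i (X x)) (Q i y) := by
      have := hx y
      rw [hB, hP0 _ _ h1 h1, hP0 _ _ h1 h1', hP0 _ _ h1' h1, hP0 _ _ h1' h1'] at this
      simpa [sub_eq_zero] using this
    have h4 : 2 * (1 - i * i) ≠ 0 := by
      rw [hi, show (2 : F) * (1 - -1) = 2 * 2 by norm_num]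
      simp [h2]
    have h0 : 2 * (1 - -i * i) = 0 := by rw [neg_mul, hi]; ring
    have hQXx : Q i (X x) = 0 := by
      refine hb _ (X x) fun y => ?_
      have := hB' (Q i y)
      rw [hQX, hQQ _ _ hi', h0, hQQ _ _ hi] at this
      simpa [h4] using this.symm
    have hXinj (y : V) (hy : X y = 0) : y = 0 := by
      rw [← hAx y, ← hXXx y, hy, map_zero, map_zero, map_zero]
    have hQ'x : Q (-i) x = 0 := hXinj _ ((hQX i x).symm.trans hQXx)
    have hQx : Q i x = 0 := by
      refine hb _ x fun y => ?_
      have := hB' (X (A (A y)))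
      rwa [hXXx, hAx, hQXx, map_zero, LinearMap.zero_apply] at this
    have hsum := LinearMap.congr_fun (sum_quaternionProj (A := A) (X := X) (i := i)) x
    change P 1 1 x + P 1 (-1) x + P (-1) 1 x + P (-1) (-1) x + (2 : F) • (Q i x + Q (-i) x)
      = (8 : F) • x at hsum
    rw [hP0 _ _ h1 h1, hP0 _ _ h1 h1', hP0 _ _ h1' h1, hP0 _ _ h1' h1', hQx, hQ'x] at hsum
    simpa [h8] using hsum.symm

/-- Every finite-dimensional representation of the quaternion group `Q₈` of
order `8` over an algebraically closed field of characteristic `≠ 2` admits a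
non-degenerate invariant bilinear form. -/
theorem exists_nondeg_invariant_form_quaternion
    (F : Type) [Field F] [IsAlgClosed F] (hF : ringChar F ≠ 2)
    (V : Type) [AddCommGroup V] [Module F V] [FiniteDimensional F V]
    (ρ : Representation F (QuaternionGroup 2) V) :
    ∃ B : V →ₗ[F] V →ₗ[F] F,
      (∀ (g : QuaternionGroup 2) (x y : V), B (ρ g x) (ρ g y) = B x y) ∧
      (∀ x : V, (∀ y : V, B x y = 0) → x = 0) := by
  obtain ⟨i, hi⟩ := IsAlgClosed.exists_eq_mul_self (-1 : F)
  obtain ⟨B, hBA, hBX, hB⟩ := exists_nondeg_form_of_quaternion_relations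
    (Ring.two_ne_zero hF) hi.symm
    (A := ρ (QuaternionGroup.a 1)) (X := ρ (QuaternionGroup.xa 0))
    (by simp only [← map_mul]; rw [← map_one ρ]; congr 1)
    (by simp only [← map_mul]; congr 1)
    (by simp only [← map_mul]; congr 1)
  have ha (k : ℕ) (x y : V) :
      B (ρ (QuaternionGroup.a 1 ^ k) x) (ρ (QuaternionGroup.a 1 ^ k) y) = B x y := by
    induction k with
    | zero => simp
    | succ k ih => rw [pow_succ', map_mul, Module.End.mul_apply, Module.End.mul_apply, hBA, ih]
  have ha' (j : ZMod (2 * 2)) (x y : V) :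
      B (ρ (QuaternionGroup.a j) x) (ρ (QuaternionGroup.a j) y) = B x y := by
    rw [← ZMod.natCast_zmod_val j, ← QuaternionGroup.a_one_pow, ha]
  refine ⟨B, fun g x y => ?_, hB⟩
  cases g with
  | a j => exact ha' j x y
  | xa j =>
    rw [← zero_add j, ← QuaternionGroup.xa_mul_a, map_mul, Module.End.mul_apply,
      Module.End.mul_apply, hBX, ha']
end

section
/- Let F be an algebraically closed field with char F ≠ 2 and let n be a positive integer. Then the number of isomorphism classes of degree-n representations of the cyclic group Z/8Z over F which admit a non-degenerate invariant bilinear form equals ∑_{s=0}^{⌊n/2⌋} C(s+2, 2) · (n−2s+1). -/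
/-- `ρ` admits a non-degenerate invariant bilinear form. -/
def HasNondegInvariantForm {F G V : Type} [Field F] [Group G]
    [AddCommGroup V] [Module F V] (ρ : Representation F G V) : Prop :=
  ∃ B : V →ₗ[F] V →ₗ[F] F,
    (∀ (g : G) (x y : V), B (ρ g x) (ρ g y) = B x y) ∧
    (∀ x : V, (∀ y : V, B x y = 0) → x = 0)

open Module Module.End

section Counting

/-- Even functions on `ℤ/8` with sum `n`, parametrised by the values at `1, 2, 3` (with sum `s`)
and at `0, 4` (with sum `n - 2 * s`). -/
theorem card_even_zmod_eight_sum_eq (n : ℕ) :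
    Nat.card {m : ZMod 8 → ℕ // ∑ k, m k = n ∧ ∀ k, m k = m (-k)} =
      ∑ s ∈ Finset.range (n / 2 + 1), (s + 2).choose 2 * (n - 2 * s + 1) := by
  let S : Finset (Σ _ : ℕ, (Σ _ : ℕ × ℕ, ℕ × ℕ) × (ℕ × ℕ)) :=
    (Finset.range (n / 2 + 1)).sigma fun s =>
      ((Finset.HasAntidiagonal.antidiagonal s).sigma fun p => Finset.HasAntidiagonal.antidiagonal p.1) ×ˢ
        Finset.HasAntidiagonal.antidiagonal (n - 2 * s)
  have hS : S.card = ∑ s ∈ Finset.range (n / 2 + 1), (s + 2).choose 2 * (n - 2 * s + 1) := by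
    simp only [S, Finset.card_sigma, Finset.card_product, Finset.Nat.card_antidiagonal]
    refine Finset.sum_congr rfl fun s _ => ?_
    congr 1
    rw [Finset.Nat.sum_antidiagonal_eq_sum_range_succ_mk]
    have h := Finset.sum_range_succ' (fun i => i) (s + 1)
    rw [Finset.sum_range_id, add_zero] at h
    rw [Nat.choose_two_right]
    exact h.symm
  have hsum : ∀ m : ZMod 8 → ℕ,
      ∑ k, m k = m 0 + m 1 + m 2 + m 3 + m 4 + m 5 + m 6 + m 7 := fun m =>
    Fin.sum_univ_eight (m : Fin 8 → ℕ)
  rw [← hS, ← Nat.card_eq_finsetCard S]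
  refine Nat.card_congr
    { toFun := fun m => ⟨⟨m.1 1 + m.1 2 + m.1 3, ⟨(m.1 1 + m.1 2, m.1 3), (m.1 1, m.1 2)⟩,
        (m.1 0, m.1 4)⟩, ?_⟩
      invFun := fun x => ⟨(![x.1.2.2.1, x.1.2.1.2.1, x.1.2.1.2.2, x.1.2.1.1.2, x.1.2.2.2,
        x.1.2.1.1.2, x.1.2.1.2.2, x.1.2.1.2.1] : Fin 8 → ℕ), ?_, ?_⟩
      left_inv := ?_
      right_inv := ?_ }
  · obtain ⟨m, hm, hneg⟩ := m
    rw [hsum] at hm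
    have h1 : m 1 = m 7 := hneg 1
    have h2 : m 2 = m 6 := hneg 2
    have h3 : m 3 = m 5 := hneg 3
    simp only [S, Finset.mem_sigma, Finset.mem_product, Finset.mem_range,
      Finset.HasAntidiagonal.mem_antidiagonal, and_self, true_and]
    omega
  · obtain ⟨⟨s, ⟨⟨p, q⟩, ⟨u, v⟩⟩, ⟨w, z⟩⟩, hx⟩ := x
    simp only [S, Finset.mem_sigma, Finset.mem_product, Finset.mem_range,
      Finset.HasAntidiagonal.mem_antidiagonal] at hx
    refine (hsum _).trans ?_
    change w + u + v + q + z + q + v + u = n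
    omega
  · intro k
    change Fin 8 at k
    fin_cases k <;> rfl
  · rintro ⟨m, hm, hneg⟩
    refine Subtype.ext (funext fun k => ?_)
    change Fin 8 at k
    fin_cases k
    exacts [rfl, rfl, rfl, rfl, rfl, hneg 3, hneg 2, hneg 1]
  · rintro ⟨⟨s, ⟨⟨p, q⟩, ⟨u, v⟩⟩, ⟨w, z⟩⟩, hx⟩
    simp only [S, Finset.mem_sigma, Finset.mem_product, Finset.mem_range,
      Finset.HasAntidiagonal.mem_antidiagonal] at hx
    obtain ⟨-, ⟨rfl, rfl⟩, -⟩ := hx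
    rfl

end Counting

section Character

variable {F : Type*} [Field F] {ζ : F}

theorem IsPrimitiveRoot.pow_zmod_val_injective (hζ : IsPrimitiveRoot ζ 8) :
    Function.Injective fun k : ZMod 8 => ζ ^ k.val := fun j k h =>
  ZMod.val_injective 8 (hζ.pow_inj (ZMod.val_lt j) (ZMod.val_lt k) h)

theorem IsPrimitiveRoot.pow_zmod_val_mul_eq_one_iff (hζ : IsPrimitiveRoot ζ 8) (j k : ZMod 8) :
    ζ ^ j.val * ζ ^ k.val = 1 ↔ j = -k := by
  rw [← pow_add, hζ.pow_eq_one_iff_dvd, ← ZMod.natCast_eq_zero_iff, Nat.cast_add,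
    ZMod.natCast_zmod_val, ZMod.natCast_zmod_val, eq_neg_iff_add_eq_zero]

end Character

namespace Representation

variable {F V W : Type*} [Field F] [AddCommGroup V] [Module F V] [AddCommGroup W] [Module F W]

/-- The isotypic component of the character sending the generator to `ζ ^ k`. -/
abbrev zmodEightEigenspace (ζ : F) (ρ : Representation F (Multiplicative (ZMod 8)) V)
    (k : ZMod 8) : Submodule F V :=
  eigenspace (ρ (Multiplicative.ofAdd 1)) (ζ ^ k.val)

theorem zmodEight_apply_eq_pow (ρ : Representation F (Multiplicative (ZMod 8)) V)
    (g : Multiplicative (ZMod 8)) :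
    ρ g = ρ (Multiplicative.ofAdd 1) ^ (g.toAdd : ZMod 8).val := by
  rw [← map_pow, ← ofAdd_nsmul, nsmul_one, ZMod.natCast_zmod_val, ofAdd_toAdd]

theorem isInternal_zmodEightEigenspace [IsAlgClosed F] [FiniteDimensional F V] {ζ : F}
    (h8 : (8 : F) ≠ 0) (hζ : IsPrimitiveRoot ζ 8)
    (ρ : Representation F (Multiplicative (ZMod 8)) V) :
    DirectSum.IsInternal (zmodEightEigenspace ζ ρ) := by
  set T : Module.End F V := ρ (Multiplicative.ofAdd 1) with hT
  have hT8 : T ^ 8 = 1 := by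
    rw [hT, ← map_pow, ← ofAdd_nsmul, nsmul_one]
    exact map_one ρ
  have hss : T.IsSemisimple := by
    refine isSemisimple_of_squarefree_aeval_eq_zero (p := Polynomial.X ^ 8 - 1)
      (Polynomial.X_pow_sub_one_separable_iff.mpr (by exact_mod_cast h8)).squarefree ?_
    simp [hT8]
  refine DirectSum.isInternal_submodule_of_iSupIndep_of_iSup_eq_top
    ((eigenspaces_iSupIndep T).comp hζ.pow_zmod_val_injective) ?_
  rw [eq_top_iff, ← iSup_maxGenEigenspace_eq_top T]
  refine iSup_le fun μ => ?_
  rw [hss.isFinitelySemisimple.maxGenEigenspace_eq_eigenspace]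
  by_cases hμ : μ ^ 8 = 1
  · obtain ⟨i, hi, rfl⟩ := hζ.eq_pow_of_pow_eq_one hμ
    refine le_trans (le_of_eq ?_) (le_iSup _ (i : ZMod 8))
    simp only [zmodEightEigenspace, ZMod.val_natCast_of_lt hi, hT]
  · intro v hv
    by_cases hv0 : v = 0
    · simp [hv0]
    · have h := HasEigenvector.pow_apply (f := T) ⟨hv, hv0⟩ 8
      rw [hT8, Module.End.one_apply] at h
      exact absurd (smul_left_injective F hv0 (by simpa using h.symm)) hμ

theorem sum_finrank_zmodEightEigenspace [IsAlgClosed F] [FiniteDimensional F V] {ζ : F}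
    (h8 : (8 : F) ≠ 0) (hζ : IsPrimitiveRoot ζ 8)
    (ρ : Representation F (Multiplicative (ZMod 8)) V) :
    ∑ k, finrank F (zmodEightEigenspace ζ ρ k) = finrank F V := by
  rw [← Module.finrank_directSum]
  exact (LinearEquiv.ofBijective (DirectSum.coeLinearMap (zmodEightEigenspace ζ ρ))
    (isInternal_zmodEightEigenspace h8 hζ ρ)).finrank_eq

theorem finrank_zmodEightEigenspace_congr {ζ : F}
    {ρ : Representation F (Multiplicative (ZMod 8)) V}
    {ρ' : Representation F (Multiplicative (ZMod 8)) W} (e : V ≃ₗ[F] W)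
    (he : ∀ g v, e (ρ g v) = ρ' g (e v)) (k : ZMod 8) :
    finrank F (zmodEightEigenspace ζ ρ k) = finrank F (zmodEightEigenspace ζ ρ' k) := by
  suffices hmap : (zmodEightEigenspace ζ ρ k).map (e : V →ₗ[F] W) = zmodEightEigenspace ζ ρ' k by
    rw [← hmap]
    exact (e.submoduleMap (zmodEightEigenspace ζ ρ k)).finrank_eq
  ext w
  rw [Submodule.mem_map_equiv, mem_eigenspace_iff, mem_eigenspace_iff, ← e.injective.eq_iff, he]
  simp

theorem exists_equiv_of_finrank_zmodEightEigenspace_eq [IsAlgClosed F] [FiniteDimensional F V]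
    [FiniteDimensional F W] {ζ : F} (h8 : (8 : F) ≠ 0) (hζ : IsPrimitiveRoot ζ 8)
    {ρ : Representation F (Multiplicative (ZMod 8)) V}
    {ρ' : Representation F (Multiplicative (ZMod 8)) W}
    (h : ∀ k, finrank F (zmodEightEigenspace ζ ρ k) = finrank F (zmodEightEigenspace ζ ρ' k)) :
    ∃ e : V ≃ₗ[F] W, ∀ g v, e (ρ g v) = ρ' g (e v) := by
  have hi := isInternal_zmodEightEigenspace h8 hζ ρ
  have hi' := isInternal_zmodEightEigenspace h8 hζ ρ'
  let v := fun k => finBasis F (zmodEightEigenspace ζ ρ k)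
  let v' := fun k => finBasisOfFinrankEq F (zmodEightEigenspace ζ ρ' k) (h k).symm
  let b := hi.collectedBasis v
  let b' := hi'.collectedBasis v'
  let e : V ≃ₗ[F] W := b.equiv b' (_root_.Equiv.refl _)
  have hgen : e.toLinearMap ∘ₗ ρ (Multiplicative.ofAdd 1) =
      ρ' (Multiplicative.ofAdd 1) ∘ₗ e.toLinearMap := by
    refine b.ext fun a => ?_
    have h1 := mem_eigenspace_iff.mp (hi.collectedBasis_mem v a)
    have h2 := mem_eigenspace_iff.mp (hi'.collectedBasis_mem v' a)
    have h3 : e (b a) = b' a := b.equiv_apply _ _ _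
    simp only [LinearMap.comp_apply, LinearEquiv.coe_coe, h3]
    rw [h1, h2, map_smul, h3]
  refine ⟨e, fun g v => ?_⟩
  rw [zmodEight_apply_eq_pow ρ, zmodEight_apply_eq_pow ρ']
  generalize (g.toAdd : ZMod 8).val = i
  induction i with
  | zero => simp
  | succ i ih =>
    rw [pow_succ', pow_succ', Module.End.mul_apply, Module.End.mul_apply, ← ih]
    exact LinearMap.congr_fun hgen _

/-- The diagonal representation with weights `c`. -/
def zmodEightDiagonal {ι : Type*} {ζ : F} (hζ : IsPrimitiveRoot ζ 8) (c : ι → ZMod 8) :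
    Representation F (Multiplicative (ZMod 8)) (ι → F) where
  toFun g := LinearMap.pi fun i => ζ ^ (c i * g.toAdd).val • LinearMap.proj i
  map_one' := by ext; simp
  map_mul' g h := by
    ext v i
    have : ζ ^ (c i * (g.toAdd + h.toAdd)).val =
        ζ ^ (c i * g.toAdd).val * ζ ^ (c i * h.toAdd).val := by
      rw [mul_add, ZMod.val_add, ← pow_add, ← pow_eq_pow_mod _ hζ.pow_eq_one]
    simp [this, mul_assoc]

theorem finrank_zmodEightEigenspace_le_neg [IsAlgClosed F] [FiniteDimensional F V] {ζ : F}
    (h8 : (8 : F) ≠ 0) (hζ : IsPrimitiveRoot ζ 8)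
    (ρ : Representation F (Multiplicative (ZMod 8)) V) (B : V →ₗ[F] V →ₗ[F] F)
    (hB : ∀ g x y, B (ρ g x) (ρ g y) = B x y) (hnd : ∀ x, (∀ y, B x y = 0) → x = 0)
    (k : ZMod 8) :
    finrank F (zmodEightEigenspace ζ ρ k) ≤ finrank F (zmodEightEigenspace ζ ρ (-k)) := by
  let f : zmodEightEigenspace ζ ρ k →ₗ[F] Dual F (zmodEightEigenspace ζ ρ (-k)) :=
    (B.domRestrict₁₂ (zmodEightEigenspace ζ ρ k) (zmodEightEigenspace ζ ρ (-k)))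
  rw [← Subspace.dual_finrank_eq (K := F) (V := zmodEightEigenspace ζ ρ (-k))]
  refine LinearMap.finrank_le_finrank_of_injective (f := f) ?_
  rw [injective_iff_map_eq_zero]
  rintro ⟨x, hx⟩ hfx
  refine Subtype.ext (hnd x fun y => ?_)
  have hy : y ∈ ⨆ j, zmodEightEigenspace ζ ρ j := by
    rw [(isInternal_zmodEightEigenspace h8 hζ ρ).submodule_iSup_eq_top]
    trivial
  refine Submodule.iSup_induction _ (motive := fun y => B x y = 0) hy (fun j y hy => ?_)
    (map_zero _) fun y z hy hz => by rw [map_add, hy, hz, add_zero]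
  by_cases hj : j = -k
  · subst hj
    exact LinearMap.congr_fun hfx ⟨y, hy⟩
  · have h := hB (Multiplicative.ofAdd 1) x y
    rw [mem_eigenspace_iff.mp hx, mem_eigenspace_iff.mp hy, map_smul, map_smul,
      LinearMap.smul_apply, smul_smul, smul_eq_mul] at h
    by_contra h0
    exact hj ((hζ.pow_zmod_val_mul_eq_one_iff j k).mp
      (mul_right_cancel₀ h0 (h.trans (one_mul _).symm)))

theorem finrank_zmodEightEigenspace_diagonal [IsAlgClosed F] {ι : Type*} [Fintype ι] {ζ : F}
    (h8 : (8 : F) ≠ 0) (hζ : IsPrimitiveRoot ζ 8) (c : ι → ZMod 8) (k : ZMod 8) :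
    finrank F (zmodEightEigenspace ζ (zmodEightDiagonal hζ c) k) =
      Fintype.card {i // c i = k} := by
  classical
  have hle : ∀ k, Fintype.card {i // c i = k} ≤
      finrank F (zmodEightEigenspace ζ (zmodEightDiagonal hζ c) k) := fun k => by
    have hmem : ∀ i : {i // c i = k},
        Pi.single (M := fun _ => F) i.1 1 ∈ zmodEightEigenspace ζ (zmodEightDiagonal hζ c) k := by
      rintro ⟨i, rfl⟩
      rw [mem_eigenspace_iff]
      ext j
      by_cases hj : j = i
      · subst hj
        simp [zmodEightDiagonal]
      · simp [zmodEightDiagonal, Pi.single_eq_of_ne hj]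
    have hli : LinearIndependent F fun i : {i // c i = k} =>
        (⟨Pi.single i.1 1, hmem i⟩ : zmodEightEigenspace ζ (zmodEightDiagonal hζ c) k) := by
      refine LinearIndependent.of_comp (Submodule.subtype _) ?_
      have h := (Pi.basisFun F ι).linearIndependent.comp (Subtype.val : {i // c i = k} → ι)
        Subtype.val_injective
      rwa [show Pi.basisFun F ι ∘ Subtype.val = fun i : {i // c i = k} => Pi.single i.1 1 from
        funext fun i => Pi.basisFun_apply F ι i.1] at h
    exact hli.fintype_card_le_finrank
  refine (((Finset.sum_eq_sum_iff_of_le fun k _ => hle k).mp ?_) k (Finset.mem_univ k)).symm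
  rw [sum_finrank_zmodEightEigenspace h8 hζ, finrank_fintype_fun_eq_card, ← Fintype.card_sigma]
  exact Fintype.card_congr (Equiv.sigmaFiberEquiv c)

theorem hasNondegInvariantForm_zmodEightDiagonal {F : Type} [Field F] {ι : Type} [Fintype ι]
    {ζ : F} (hζ : IsPrimitiveRoot ζ 8) (c : ι → ZMod 8) (σ : ι ≃ ι) (hσ : ∀ i, c (σ i) = -c i) :
    HasNondegInvariantForm (zmodEightDiagonal hζ c) := by
  classical
  refine ⟨LinearMap.mk₂ F (fun x y => ∑ i, x i * y (σ i)) ?_ ?_ ?_ ?_, fun g x y => ?_,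
    fun x hx => funext fun i => ?_⟩
  · intro x y z
    simp [add_mul, Finset.sum_add_distrib]
  · intro a x y
    simp [Finset.mul_sum, mul_assoc]
  · intro x y z
    simp [mul_add, Finset.sum_add_distrib]
  · intro a x y
    simp [Finset.mul_sum, mul_left_comm]
  · simp only [LinearMap.mk₂_apply]
    refine Finset.sum_congr rfl fun i _ => ?_
    have h : ζ ^ (c i * g.toAdd).val * ζ ^ (c (σ i) * g.toAdd).val = 1 := by
      rw [hζ.pow_zmod_val_mul_eq_one_iff, hσ, neg_mul, neg_neg]
    change (ζ ^ (c i * g.toAdd).val * x i) * (ζ ^ (c (σ i) * g.toAdd).val * y (σ i)) = _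
    rw [mul_mul_mul_comm, h, one_mul]
  · simpa [Pi.single_apply] using hx (Pi.single (σ i) 1)

end Representation

/-- The number of isomorphism classes of degree-`n` representations of `ℤ/8`
over an algebraically closed field of characteristic `≠ 2` which admit a
non-degenerate invariant bilinear form is
`∑_{s=0}^{⌊n/2⌋} C(s+2, 2)·(n-2s+1)`. -/
theorem numRep_nondeg_z8 (F : Type) [Field F] [IsAlgClosed F]
    (hF : ringChar F ≠ 2) (n : ℕ) (hn : 0 < n) :
    Nat.card (Quot fun (ρ ρ' :
        {ρ : Representation F (Multiplicative (ZMod 8)) (Fin n → F) //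
          HasNondegInvariantForm ρ}) =>
        repIsoRel F (Multiplicative (ZMod 8)) n ρ.1 ρ'.1) =
      ∑ s ∈ Finset.range (n / 2 + 1), (s + 2).choose 2 * (n - 2 * s + 1) := by
  have h2 : (2 : F) ≠ 0 := Ring.two_ne_zero hF
  have h8 : (8 : F) ≠ 0 := by
    rw [show (8 : F) = 2 ^ 3 by norm_num]
    exact pow_ne_zero 3 h2
  have : NeZero ((8 : ℕ) : F) := ⟨by exact_mod_cast h8⟩
  obtain ⟨ζ, hζ⟩ := HasEnoughRootsOfUnity.exists_primitiveRoot F 8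
  rw [← card_even_zmod_eight_sum_eq]
  refine Nat.card_eq_of_bijective (Quot.lift (fun ρ =>
    (⟨fun k => Module.finrank F (ρ.1.zmodEightEigenspace ζ k), ?_, ?_⟩ :
      {m : ZMod 8 → ℕ // ∑ k, m k = n ∧ ∀ k, m k = m (-k)})) ?_) ⟨?_, ?_⟩
  · rw [Representation.sum_finrank_zmodEightEigenspace h8 hζ, Module.finrank_fin_fun]
  · obtain ⟨B, hB, hnd⟩ := ρ.2
    intro k
    refine le_antisymm
      (Representation.finrank_zmodEightEigenspace_le_neg h8 hζ ρ.1 B hB hnd k) ?_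
    have h := Representation.finrank_zmodEightEigenspace_le_neg h8 hζ ρ.1 B hB hnd (-k)
    rwa [neg_neg] at h
  · rintro ρ ρ' ⟨e, he⟩
    exact Subtype.ext (funext (Representation.finrank_zmodEightEigenspace_congr e he))
  · rintro ⟨ρ⟩ ⟨ρ'⟩ h
    exact Quot.sound (Representation.exists_equiv_of_finrank_zmodEightEigenspace_eq h8 hζ
      (congrFun (Subtype.ext_iff.mp h)))
  · rintro ⟨m, hm, hneg⟩
    let e : Fin n ≃ Σ k, Fin (m k) := Fintype.equivOfCardEq (by simp [hm])
    let τ : (Σ k, Fin (m k)) ≃ Σ k, Fin (m k) :=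
      Equiv.sigmaCongr (Equiv.neg (ZMod 8)) fun k => finCongr (hneg k)
    refine ⟨Quot.mk _ ⟨Representation.zmodEightDiagonal hζ fun i => (e i).1,
      Representation.hasNondegInvariantForm_zmodEightDiagonal hζ _ ((e.trans τ).trans e.symm)
        fun i => ?_⟩, Subtype.ext (funext fun k => ?_)⟩
    · simp [τ, Equiv.sigmaCongr]
    · change Module.finrank F _ = m k
      rw [Representation.finrank_zmodEightEigenspace_diagonal h8 hζ,
        Fintype.card_congr (e.subtypeEquiv (q := fun x => x.1 = k) fun i => Iff.rfl),
        Fintype.card_congr (Equiv.sigmaSubtype k), Fintype.card_fin]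
end

section
/- Let F be an algebraically closed field with char F ≠ 2 and let n be a positive integer. Then the number of isomorphism classes of degree-n representations of the abelian group Z/4 × Z/2 over F which admit a non-degenerate invariant bilinear form equals ∑_{s=0}^{⌊n/2⌋} (s+1) · C(n−2s+3, 3). -/
section WeightSpaces

variable {F R V : Type} [Field F] [CommRing R] [AddCommGroup V] [Module F V]

/-- The subspace on which `Multiplicative R` acts through the character `r ↦ ψ (c * r)`. -/
def weightSpace (ψ : AddChar R F) (ρ : Representation F (Multiplicative R) V) (c : R) :
    Submodule F V where
  carrier := {v | ∀ r : R, ρ (Multiplicative.ofAdd r) v = ψ (c * r) • v}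
  add_mem' hx hy r := by rw [map_add, hx r, hy r, smul_add]
  zero_mem' r := by simp
  smul_mem' a x hx r := by rw [map_smul, hx r, smul_comm]

theorem mem_weightSpace {ψ : AddChar R F} {ρ : Representation F (Multiplicative R) V} {c : R}
    {v : V} :
    v ∈ weightSpace ψ ρ c ↔ ∀ r : R, ρ (Multiplicative.ofAdd r) v = ψ (c * r) • v :=
  Iff.rfl

theorem finrank_weightSpace_eq_of_equiv {V' : Type} [AddCommGroup V'] [Module F V']
    (ψ : AddChar R F) {ρ : Representation F (Multiplicative R) V}
    {ρ' : Representation F (Multiplicative R) V'} (e : V ≃ₗ[F] V')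
    (he : ∀ g v, e (ρ g v) = ρ' g (e v)) (c : R) :
    Module.finrank F (weightSpace ψ ρ c) = Module.finrank F (weightSpace ψ ρ' c) := by
  have h : (weightSpace ψ ρ c).map (e : V →ₗ[F] V') = weightSpace ψ ρ' c := by
    ext v
    simp only [Submodule.mem_map, mem_weightSpace, LinearEquiv.coe_coe]
    constructor
    · rintro ⟨w, hw, rfl⟩ r
      rw [← he, hw, map_smul]
    · intro hv
      refine ⟨e.symm v, fun r => e.injective ?_, e.apply_symm_apply v⟩
      rw [he, map_smul, e.apply_symm_apply, hv]
  rw [← h]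
  exact (e.submoduleMap (weightSpace ψ ρ c)).finrank_eq

variable [Fintype R]

/-- The projection onto `weightSpace ψ ρ c` obtained by averaging over the group. -/
noncomputable def weightProj (ψ : AddChar R F) (ρ : Representation F (Multiplicative R) V)
    (c : R) : V →ₗ[F] V :=
  (Fintype.card R : F)⁻¹ • ∑ r : R, ψ (-(c * r)) • ρ (Multiplicative.ofAdd r)

theorem weightProj_apply (ψ : AddChar R F) (ρ : Representation F (Multiplicative R) V)
    (c : R) (v : V) :
    weightProj ψ ρ c v =
      (Fintype.card R : F)⁻¹ • ∑ r : R, ψ (-(c * r)) • ρ (Multiplicative.ofAdd r) v := by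
  simp [weightProj, LinearMap.sum_apply]

theorem weightProj_mem (ψ : AddChar R F) (ρ : Representation F (Multiplicative R) V)
    (c : R) (v : V) : weightProj ψ ρ c v ∈ weightSpace ψ ρ c := by
  intro s
  rw [weightProj_apply, map_smul, map_sum, smul_comm]
  congr 1
  rw [Finset.smul_sum]
  refine Fintype.sum_equiv (Equiv.addLeft s) _
    (fun r => ψ (c * s) • ψ (-(c * r)) • ρ (Multiplicative.ofAdd r) v) fun r => ?_
  rw [map_smul, ← Module.End.mul_apply, ← map_mul, ← ofAdd_add, smul_smul,
    ← AddChar.map_add_eq_mul, Equiv.coe_addLeft]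
  congr 2
  ring

variable [DecidableEq R] {ψ : AddChar R F}

theorem weightProj_of_mem (hψ : ψ.IsPrimitive) (hR : (Fintype.card R : F) ≠ 0)
    {ρ : Representation F (Multiplicative R) V} {c d : R} {v : V}
    (hv : v ∈ weightSpace ψ ρ d) : weightProj ψ ρ c v = if d = c then v else 0 := by
  have h : ∀ r : R, ψ (-(c * r)) • ρ (Multiplicative.ofAdd r) v = ψ (r * (d - c)) • v := by
    intro r
    rw [hv r, smul_smul, ← AddChar.map_add_eq_mul]
    congr 2
    ring
  rw [weightProj_apply, Finset.sum_congr rfl fun r _ => h r, ← Finset.sum_smul,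
    AddChar.sum_mulShift _ hψ]
  simp only [sub_eq_zero]
  split_ifs
  · rw [smul_smul, inv_mul_cancel₀ hR, one_smul]
  · simp

theorem sum_weightProj (hψ : ψ.IsPrimitive) (hR : (Fintype.card R : F) ≠ 0)
    (ρ : Representation F (Multiplicative R) V) (v : V) : ∑ c, weightProj ψ ρ c v = v := by
  simp only [weightProj_apply]
  rw [← Finset.smul_sum, Finset.sum_comm]
  have h : ∀ r : R, ∑ c : R, ψ (-(c * r)) • ρ (Multiplicative.ofAdd r) v =
      if r = 0 then (Fintype.card R : F) • v else 0 := by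
    intro r
    simp only [← mul_neg]
    rw [← Finset.sum_smul, AddChar.sum_mulShift _ hψ]
    simp only [neg_eq_zero]
    split_ifs with hr
    · simp [hr]
    · simp
  simp only [h, Finset.sum_ite_eq', Finset.mem_univ, if_true]
  rw [smul_smul, inv_mul_cancel₀ hR, one_smul]

theorem isInternal_weightSpace (hψ : ψ.IsPrimitive) (hR : (Fintype.card R : F) ≠ 0)
    (ρ : Representation F (Multiplicative R) V) :
    DirectSum.IsInternal (weightSpace ψ ρ) := by
  rw [DirectSum.isInternal_submodule_iff_iSupIndep_and_iSup_eq_top]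
  constructor
  · intro c
    rw [Submodule.disjoint_def]
    intro v hv hv'
    have hle : ⨆ d, ⨆ (_ : d ≠ c), weightSpace ψ ρ d ≤ LinearMap.ker (weightProj ψ ρ c) := by
      refine iSup₂_le fun d hd w hw => ?_
      rw [LinearMap.mem_ker, weightProj_of_mem hψ hR hw, if_neg hd]
    have h := weightProj_of_mem hψ hR (c := c) hv
    rw [if_pos rfl] at h
    rw [← h]
    exact hle hv'
  · rw [eq_top_iff]
    intro v _
    rw [← sum_weightProj hψ hR ρ v]
    exact Submodule.sum_mem _ fun c _ =>
      Submodule.mem_iSup_of_mem c (weightProj_mem ψ ρ c v)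

variable [FiniteDimensional F V]

/-- A basis of `V` consisting of weight vectors. -/
noncomputable def weightBasis (hψ : ψ.IsPrimitive) (hR : (Fintype.card R : F) ≠ 0)
    (ρ : Representation F (Multiplicative R) V) :
    Module.Basis (Σ c : R, Fin (Module.finrank F (weightSpace ψ ρ c))) F V :=
  (isInternal_weightSpace hψ hR ρ).collectedBasis fun c =>
    Module.finBasis F (weightSpace ψ ρ c)

theorem apply_weightBasis (hψ : ψ.IsPrimitive) (hR : (Fintype.card R : F) ≠ 0)
    (ρ : Representation F (Multiplicative R) V)
    (j : Σ c : R, Fin (Module.finrank F (weightSpace ψ ρ c))) (r : R) :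
    ρ (Multiplicative.ofAdd r) (weightBasis hψ hR ρ j) =
      ψ (j.1 * r) • weightBasis hψ hR ρ j :=
  (isInternal_weightSpace hψ hR ρ).collectedBasis_mem _ j r

theorem sum_finrank_weightSpace (hψ : ψ.IsPrimitive) (hR : (Fintype.card R : F) ≠ 0)
    (ρ : Representation F (Multiplicative R) V) :
    ∑ c, Module.finrank F (weightSpace ψ ρ c) = Module.finrank F V := by
  rw [Module.finrank_eq_card_basis (weightBasis hψ hR ρ)]
  simp

theorem exists_equiv_of_finrank_weightSpace_eq {V' : Type} [AddCommGroup V'] [Module F V']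
    [FiniteDimensional F V'] (hψ : ψ.IsPrimitive) (hR : (Fintype.card R : F) ≠ 0)
    (ρ : Representation F (Multiplicative R) V) (ρ' : Representation F (Multiplicative R) V')
    (h : ∀ c, Module.finrank F (weightSpace ψ ρ c) = Module.finrank F (weightSpace ψ ρ' c)) :
    ∃ e : V ≃ₗ[F] V', ∀ g v, e (ρ g v) = ρ' g (e v) := by
  let e := (weightBasis hψ hR ρ).equiv (weightBasis hψ hR ρ')
    (Equiv.sigmaCongrRight fun c => finCongr (h c))
  refine ⟨e, fun g v => ?_⟩
  suffices H : e.toLinearMap ∘ₗ ρ g = ρ' g ∘ₗ e.toLinearMap from LinearMap.congr_fun H v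
  refine (weightBasis hψ hR ρ).ext fun j => ?_
  obtain ⟨r, rfl⟩ := Multiplicative.ofAdd.surjective g
  simp only [LinearMap.comp_apply, LinearEquiv.coe_coe, apply_weightBasis, map_smul, e,
    Module.Basis.equiv_apply]
  rfl

theorem finrank_weightSpace_le_neg (hψ : ψ.IsPrimitive) (hR : (Fintype.card R : F) ≠ 0)
    {ρ : Representation F (Multiplicative R) V} (hρ : HasNondegInvariantForm ρ) (c : R) :
    Module.finrank F (weightSpace ψ ρ c) ≤ Module.finrank F (weightSpace ψ ρ (-c)) := by
  obtain ⟨B, hB, hnd⟩ := hρ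
  rw [← Subspace.dual_finrank_eq (V := weightSpace ψ ρ (-c))]
  refine LinearMap.finrank_le_finrank_of_injective
    (f := B.domRestrict₁₂ (weightSpace ψ ρ c) (weightSpace ψ ρ (-c))) ?_
  rw [injective_iff_map_eq_zero]
  rintro ⟨x, hx⟩ h0
  have horth : ∀ d, d ≠ -c → ∀ y ∈ weightSpace ψ ρ d, B x y = 0 := by
    intro d hd y hy
    have hcd : c + d ≠ 0 := fun h => hd (eq_neg_of_add_eq_zero_right h)
    obtain ⟨r, hr⟩ := AddChar.ne_one_iff.mp (hψ hcd)
    have h := hB (Multiplicative.ofAdd r) x y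
    rw [hx r, hy r, map_smul, map_smul, LinearMap.smul_apply, smul_smul,
      ← AddChar.map_add_eq_mul, smul_eq_mul] at h
    rw [AddChar.mulShift_apply] at hr
    by_contra hxy
    refine hr (mul_right_cancel₀ hxy ?_)
    rw [one_mul, ← h]
    congr 2
    ring
  ext
  refine hnd x fun y => ?_
  rw [← sum_weightProj hψ hR ρ y, map_sum]
  refine Finset.sum_eq_zero fun d _ => ?_
  by_cases hd : d = -c
  · subst hd
    exact LinearMap.congr_fun h0 ⟨_, weightProj_mem ψ ρ (-c) y⟩
  · exact horth d hd _ (weightProj_mem ψ ρ d y)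

theorem hasNondegInvariantForm_iff (hψ : ψ.IsPrimitive) (hR : (Fintype.card R : F) ≠ 0)
    (ρ : Representation F (Multiplicative R) V) :
    HasNondegInvariantForm ρ ↔ ∀ c,
      Module.finrank F (weightSpace ψ ρ (-c)) = Module.finrank F (weightSpace ψ ρ c) := by
  constructor
  · intro h c
    refine le_antisymm ?_ (finrank_weightSpace_le_neg hψ hR h c)
    have h' := finrank_weightSpace_le_neg hψ hR h (-c)
    rwa [neg_neg] at h'
  · intro h
    let b := weightBasis hψ hR ρ
    let σ : (Σ c : R, Fin (Module.finrank F (weightSpace ψ ρ c))) ≃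
        (Σ c : R, Fin (Module.finrank F (weightSpace ψ ρ c))) :=
      Equiv.sigmaCongr (Equiv.neg R) fun c => finCongr (h c).symm
    let B : V →ₗ[F] V →ₗ[F] F := b.constr F fun j => b.coord (σ j)
    have hBb : ∀ i j, B (b i) (b j) = if j = σ i then 1 else 0 := by
      intro i j
      simp [B, Finsupp.single_apply]
    refine ⟨B, fun g x y => ?_, fun x hx => ?_⟩
    · suffices H : B.compl₁₂ (ρ g) (ρ g) = B from LinearMap.congr_fun₂ H x y
      refine b.ext fun i => b.ext fun j => ?_
      obtain ⟨r, rfl⟩ := Multiplicative.ofAdd.surjective g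
      simp only [LinearMap.compl₁₂_apply, b, apply_weightBasis, map_smul, LinearMap.smul_apply]
      change ψ (j.1 * r) • ψ (i.1 * r) • B (b i) (b j) = B (b i) (b j)
      rw [hBb]
      split_ifs with hij
      · subst hij
        have hσ : (σ i).1 = -i.1 := rfl
        rw [hσ, smul_smul, ← AddChar.map_add_eq_mul, neg_mul, neg_add_cancel,
          AddChar.map_zero_eq_one, one_smul]
      · simp
    · refine b.ext_elem fun i => ?_
      have h1 := hx (b (σ i))
      have h2 : B x (b (σ i)) = b.repr x i := by
        conv_lhs => rw [← b.sum_repr x]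
        rw [map_sum, LinearMap.sum_apply]
        simp [hBb]
      rw [← h2, h1, map_zero, Finsupp.zero_apply]

/-- Every multiplicity vector of total `n` is realised by a representation of degree `n`. -/
theorem exists_representation_finrank_weightSpace (hψ : ψ.IsPrimitive)
    (hR : (Fintype.card R : F) ≠ 0) {n : ℕ} (m : R → ℕ) (hm : ∑ c, m c = n) :
    ∃ ρ : Representation F (Multiplicative R) (Fin n → F),
      ∀ c, Module.finrank F (weightSpace ψ ρ c) = m c := by
  have hcard : Fintype.card (Fin n) = Fintype.card (Σ c : R, Fin (m c)) := by simp [hm]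
  let e := Fintype.equivOfCardEq hcard
  let b : Module.Basis (Σ c : R, Fin (m c)) F (Fin n → F) := (Pi.basisFun F (Fin n)).reindex e
  let ρ : Representation F (Multiplicative R) (Fin n → F) :=
    { toFun := fun g => b.constr F fun j => ψ (j.1 * g.toAdd) • b j
      map_one' := b.ext fun j => by simp
      map_mul' := fun g g' => b.ext fun j => by
        simp [mul_add, AddChar.map_add_eq_mul, smul_smul, mul_comm] }
  have hρ : ∀ j, b j ∈ weightSpace ψ ρ j.1 := fun j r => by
    simp [ρ]
  have hle : ∀ c ∈ Finset.univ, m c ≤ Module.finrank F (weightSpace ψ ρ c) := by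
    intro c _
    have hli : LinearIndependent F
        (fun j : Fin (m c) => (⟨b ⟨c, j⟩, hρ ⟨c, j⟩⟩ : weightSpace ψ ρ c)) := by
      refine LinearIndependent.of_comp (weightSpace ψ ρ c).subtype ?_
      exact b.linearIndependent.comp _ sigma_mk_injective
    simpa using hli.fintype_card_le_finrank
  have hsum := (Finset.sum_eq_sum_iff_of_le hle).mp (by
    rw [sum_finrank_weightSpace hψ hR, hm]; simp)
  exact ⟨ρ, fun c => (hsum c (Finset.mem_univ c)).symm⟩

/-- Isomorphism classes with a non-degenerate invariant form correspond to symmetric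
multiplicity vectors. -/
theorem card_quot_eq_card_symmetric (hψ : ψ.IsPrimitive) (hR : (Fintype.card R : F) ≠ 0)
    (n : ℕ) :
    Nat.card (Quot fun (ρ ρ' : {ρ : Representation F (Multiplicative R) (Fin n → F) //
        HasNondegInvariantForm ρ}) => repIsoRel F (Multiplicative R) n ρ.1 ρ'.1) =
      Nat.card {m : R → ℕ // ∑ c, m c = n ∧ ∀ c, m (-c) = m c} := by
  refine Nat.card_congr (Equiv.ofBijective (Quot.lift (fun ρ =>
    ⟨fun c => Module.finrank F (weightSpace ψ ρ.1 c),
      by rw [sum_finrank_weightSpace hψ hR, Module.finrank_fin_fun],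
      (hasNondegInvariantForm_iff hψ hR ρ.1).mp ρ.2⟩) ?_) ⟨?_, ?_⟩)
  · rintro ρ ρ' ⟨e, he⟩
    exact Subtype.ext (funext (finrank_weightSpace_eq_of_equiv ψ e he))
  · rintro ⟨ρ⟩ ⟨ρ'⟩ h
    exact Quot.sound (exists_equiv_of_finrank_weightSpace_eq hψ hR ρ.1 ρ'.1
      (congrFun (Subtype.ext_iff.mp h)))
  · rintro ⟨m, hm, hsymm⟩
    obtain ⟨ρ, hρ⟩ := exists_representation_finrank_weightSpace hψ hR m hm
    refine ⟨Quot.mk _ ⟨ρ, (hasNondegInvariantForm_iff hψ hR ρ).mpr fun c => ?_⟩,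
      Subtype.ext (funext hρ)⟩
    rw [hρ, hρ, hsymm]

end WeightSpaces

theorem exists_isPrimitive_zmod_four_prod_zmod_two (F : Type) [Field F] [IsAlgClosed F]
    (h2 : (2 : F) ≠ 0) : ∃ ψ : AddChar (ZMod 4 × ZMod 2) F, ψ.IsPrimitive := by
  obtain ⟨i, hi⟩ := IsAlgClosed.exists_pow_nat_eq (-1 : F) (n := 2) two_pos
  have hi4 : i ^ 4 = 1 := by linear_combination (i ^ 2 - 1) * hi
  have hne : (-1 : F) ≠ 1 := fun h => h2 (by linear_combination -h)
  have hi1 : i ≠ 1 := by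
    rintro rfl
    exact hne (by rw [← hi, one_pow])
  have hi3 : i ^ 3 ≠ 1 := fun h => hi1 (by linear_combination hi4 - i * h)
  let ψ : AddChar (ZMod 4 × ZMod 2) F :=
    { toFun := fun a => AddChar.zmodChar 4 hi4 a.1 *
        AddChar.zmodChar 2 (neg_one_sq : (-1 : F) ^ 2 = 1) a.2
      map_zero_eq_one' := by simp
      map_add_eq_mul' := fun a b => by
        rw [Prod.fst_add, Prod.snd_add, AddChar.map_add_eq_mul, AddChar.map_add_eq_mul,
          mul_mul_mul_comm] }
  have hψ : ∀ a, ψ a = i ^ a.1.val * (-1) ^ a.2.val := fun a => rfl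
  refine ⟨ψ, fun a ha h => ?_⟩
  have h10 := DFunLike.congr_fun h (1, 0)
  have h01 := DFunLike.congr_fun h (0, 1)
  rw [AddChar.mulShift_apply, AddChar.one_apply, hψ] at h10 h01
  obtain ⟨x, y⟩ := a
  have hx : x = 0 := by
    fin_cases x
    · rfl
    · change i ^ 1 * (-1) ^ (y * 0).val = 1 at h10
      exact absurd (by simpa using h10) hi1
    · change i ^ 2 * (-1) ^ (y * 0).val = 1 at h10
      exact absurd (by simpa [hi] using h10) hne
    · change i ^ 3 * (-1) ^ (y * 0).val = 1 at h10
      exact absurd (by simpa using h10) hi3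
  have hy : y = 0 := by
    fin_cases y
    · rfl
    · change i ^ (x * 0).val * (-1) ^ 1 = 1 at h01
      exact absurd (by simpa using h01) hne
  exact ha (by rw [hx, hy]; rfl)

theorem card_fun_sum_eq (α : Type) [Fintype α] [DecidableEq α] (n : ℕ) :
    Nat.card {p : α → ℕ // ∑ i, p i = n} = (Fintype.card α).multichoose n := by
  rw [← Nat.card_congr (Sym.equivNatSumOfFintype α n), Nat.card_eq_fintype_card,
    Sym.card_sym_eq_multichoose]

theorem card_symmetric_zmod_four_prod_zmod_two (n : ℕ) :
    Nat.card {m : ZMod 4 × ZMod 2 → ℕ // ∑ c, m c = n ∧ ∀ c, m (-c) = m c} =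
      ∑ s ∈ Finset.range (n / 2 + 1), (s + 1) * (n - 2 * s + 3).choose 3 := by
  have hsum : ∀ m : ZMod 4 × ZMod 2 → ℕ, ∑ c, m c =
      m (0, 0) + m (0, 1) + (m (1, 0) + m (1, 1)) + (m (2, 0) + m (2, 1)) +
        (m (3, 0) + m (3, 1)) := by
    intro m
    rw [Fintype.sum_prod_type]
    change ∑ x : Fin 4, ∑ y : Fin 2, _ = _
    simp only [Fin.sum_univ_four, Fin.sum_univ_two]
    rfl
  let e : {m : ZMod 4 × ZMod 2 → ℕ // ∑ c, m c = n ∧ ∀ c, m (-c) = m c} ≃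
      Σ s : Fin (n / 2 + 1), {q : Fin 2 → ℕ // ∑ i, q i = s} ×
        {p : Fin 4 → ℕ // ∑ i, p i = n - 2 * s} :=
    { toFun := fun m => ⟨⟨m.1 (1, 0) + m.1 (1, 1), by
          have h := m.2.1
          rw [hsum] at h
          have h0 : m.1 (3, 0) = m.1 (1, 0) := m.2.2 (1, 0)
          have h1 : m.1 (3, 1) = m.1 (1, 1) := m.2.2 (1, 1)
          omega⟩,
        ⟨![m.1 (1, 0), m.1 (1, 1)], by simp⟩,
        ⟨![m.1 (0, 0), m.1 (0, 1), m.1 (2, 0), m.1 (2, 1)], by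
          have h := m.2.1
          rw [hsum] at h
          have h0 : m.1 (3, 0) = m.1 (1, 0) := m.2.2 (1, 0)
          have h1 : m.1 (3, 1) = m.1 (1, 1) := m.2.2 (1, 1)
          simp [Fin.sum_univ_four]
          omega⟩⟩
      invFun := fun x => ⟨fun c => (![![x.2.2.1 0, x.2.2.1 1], x.2.1.1,
          ![x.2.2.1 2, x.2.2.1 3], x.2.1.1] : Fin 4 → Fin 2 → ℕ) c.1 c.2, by
          obtain ⟨⟨s, hs⟩, ⟨q, hq⟩, ⟨p, hp⟩⟩ := x
          rw [hsum]
          simp only [Fin.sum_univ_four, Fin.sum_univ_two] at hp hq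
          change p 0 + p 1 + (q 0 + q 1) + (p 2 + p 3) + (q 0 + q 1) = n
          omega, by
          rintro ⟨c, d⟩
          fin_cases c <;> fin_cases d <;> rfl⟩
      left_inv := by
        rintro ⟨m, hm, hs⟩
        ext ⟨c, d⟩
        have h0 : m (3, 0) = m (1, 0) := hs (1, 0)
        have h1 : m (3, 1) = m (1, 1) := hs (1, 1)
        fin_cases c <;> fin_cases d <;> first | rfl | exact h0.symm | exact h1.symm
      right_inv := by
        rintro ⟨⟨s, hs⟩, ⟨q, hq⟩, ⟨p, hp⟩⟩
        obtain rfl : q 0 + q 1 = s := by simpa using hq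
        refine Sigma.ext rfl (heq_of_eq (Prod.ext (Subtype.ext ?_) (Subtype.ext ?_)))
        · ext j
          fin_cases j <;> rfl
        · ext j
          fin_cases j <;> rfl }
  have hfin : ∀ (k N : ℕ), Finite {p : Fin k → ℕ // ∑ i, p i = N} := fun k N =>
    Finite.of_equiv _ (Sym.equivNatSumOfFintype (Fin k) N)
  rw [Nat.card_congr e, Nat.card_sigma, ← Fin.sum_univ_eq_sum_range
    fun s => (s + 1) * (n - 2 * s + 3).choose 3]
  refine Finset.sum_congr rfl fun s _ => ?_
  rw [Nat.card_prod, card_fun_sum_eq, card_fun_sum_eq, Fintype.card_fin, Fintype.card_fin,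
    Nat.multichoose_two, Nat.multichoose_eq]
  congr 1
  rw [show 4 + (n - 2 * (s : ℕ)) - 1 = (n - 2 * s) + 3 by omega, Nat.choose_symm_add]

/-- The number of isomorphism classes of degree-`n` representations of
`ℤ/4 × ℤ/2` over an algebraically closed field of characteristic `≠ 2` which
admit a non-degenerate invariant bilinear form is
`∑_{s=0}^{⌊n/2⌋} (s+1)·C(n-2s+3, 3)`. -/
theorem numRep_nondeg_z4xz2 (F : Type) [Field F] [IsAlgClosed F]
    (hF : ringChar F ≠ 2) (n : ℕ) (hn : 0 < n) :
    Nat.card (Quot fun (ρ ρ' :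
        {ρ : Representation F (Multiplicative (ZMod 4 × ZMod 2)) (Fin n → F) //
          HasNondegInvariantForm ρ}) =>
        repIsoRel F (Multiplicative (ZMod 4 × ZMod 2)) n ρ.1 ρ'.1) =
      ∑ s ∈ Finset.range (n / 2 + 1), (s + 1) * (n - 2 * s + 3).choose 3 := by
  have h2 : (2 : F) ≠ 0 := Ring.two_ne_zero hF
  obtain ⟨ψ, hψ⟩ := exists_isPrimitive_zmod_four_prod_zmod_two F h2
  have hR : (Fintype.card (ZMod 4 × ZMod 2) : F) ≠ 0 := by
    rw [Fintype.card_prod, ZMod.card, ZMod.card]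
    have h8 : ((4 * 2 : ℕ) : F) = 2 ^ 3 := by norm_num
    rw [h8]
    exact pow_ne_zero 3 h2
  rw [card_quot_eq_card_symmetric hψ hR, card_symmetric_zmod_four_prod_zmod_two]
end
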